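/- Let A be a fanning frame with coefficient curves P_1,…,P_k, and let X : ℝ → Matrix (Fin n) (Fin n) ℝ be smooth with X(0) = I, X(t) invertible for every t, and X'(t) = −X(t)P_1(t) for all t. Then B(t) := A(t)X(t)⁻¹ is a fanning frame whose coefficient curves Q_1,…,Q_k satisfy Q_j(t) = Σ_{i=0}^{j} C(j,i) X^{(j−i)}(t) P_i(t) X(t)⁻¹ for all t and all 1 ≤ j ≤ k, where P_0 := I_n. In particular Q_1 ≡ 0 (so B is normal) and Q_2(t) = X(t)(P_2(t) − P_1(t)² − P_1'(t))X(t)⁻¹. -/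

import Mathlib

open Matrix

noncomputable def mderiv {M N : ℕ} (A : ℝ → Matrix (Fin M) (Fin N) ℝ) :
    ℝ → Matrix (Fin M) (Fin N) ℝ :=
  fun t => Matrix.of fun i j => deriv (fun s => A s i j) t

noncomputable def dmat {M N : ℕ} (i : ℕ) (A : ℝ → Matrix (Fin M) (Fin N) ℝ) :
    ℝ → Matrix (Fin M) (Fin N) ℝ :=
  mderiv^[i] A

def MatSmooth {M N : ℕ} (A : ℝ → Matrix (Fin M) (Fin N) ℝ) : Prop :=
  ∀ i j, ContDiff ℝ (⊤ : ℕ∞) fun t => A t i j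

def juxt (k n : ℕ) (B : Fin k → Matrix (Fin (k * n)) (Fin n) ℝ) :
    Matrix (Fin (k * n)) (Fin (k * n)) ℝ :=
  Matrix.of fun r c => B (finProdFinEquiv.symm c).1 r (finProdFinEquiv.symm c).2

noncomputable def frameMat (k n : ℕ) (A : ℝ → Matrix (Fin (k * n)) (Fin n) ℝ) (t : ℝ) :
    Matrix (Fin (k * n)) (Fin (k * n)) ℝ :=
  juxt k n fun i => dmat (i : ℕ) A t

def IsFanning (k n : ℕ) (A : ℝ → Matrix (Fin (k * n)) (Fin n) ℝ) : Prop :=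
  MatSmooth A ∧ ∀ t, IsUnit (frameMat k n A t)

def IsCoeffs (k n : ℕ) (A : ℝ → Matrix (Fin (k * n)) (Fin n) ℝ)
    (P : ℕ → ℝ → Matrix (Fin n) (Fin n) ℝ) : Prop :=
  (∀ i ∈ Finset.Icc 1 k, MatSmooth (P i)) ∧
  ∀ t, dmat k A t + ∑ i ∈ Finset.Icc 1 k, (k.choose i : ℝ) • (dmat (k - i) A t * P i t) = 0

theorem dmat_apply {M N : ℕ} (m : ℕ) (A : ℝ → Matrix (Fin M) (Fin N) ℝ) (t : ℝ)
    (r : Fin M) (c : Fin N) : dmat m A t r c = iteratedDeriv m (fun s => A s r c) t := by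
  induction m generalizing t with
  | zero => simp [dmat]
  | succ m ih =>
    rw [dmat, Function.iterate_succ_apply', iteratedDeriv_succ]
    exact congrArg (fun f => deriv f t) (funext ih)

theorem matSmooth_mul {M N L : ℕ} {A : ℝ → Matrix (Fin M) (Fin N) ℝ}
    {B : ℝ → Matrix (Fin N) (Fin L) ℝ} (hA : MatSmooth A) (hB : MatSmooth B) :
    MatSmooth fun t => A t * B t := fun i j => by
  simp only [Matrix.mul_apply]
  exact ContDiff.sum fun l _ => (hA i l).mul (hB l j)

theorem MatSmooth.contDiff_det {N : ℕ} {X : ℝ → Matrix (Fin N) (Fin N) ℝ} (hX : MatSmooth X) :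
    ContDiff ℝ (⊤ : ℕ∞) fun t => (X t).det := by
  simp only [Matrix.det_apply']
  exact ContDiff.sum fun σ _ => contDiff_const.mul (contDiff_prod fun i _ => hX (σ i) i)

theorem MatSmooth.inv {N : ℕ} {X : ℝ → Matrix (Fin N) (Fin N) ℝ} (hX : MatSmooth X)
    (hXu : ∀ t, IsUnit (X t)) : MatSmooth fun t => (X t)⁻¹ := fun i j => by
  simp only [Matrix.inv_def, Matrix.smul_apply, Matrix.adjugate_apply, Ring.inverse_eq_inv',
    smul_eq_mul]
  refine (hX.contDiff_det.inv fun t => ((Matrix.isUnit_iff_isUnit_det _).1 (hXu t)).ne_zero).mul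
    (MatSmooth.contDiff_det fun r c => ?_)
  simp only [Matrix.updateRow_apply]
  split_ifs
  · exact contDiff_const
  · exact hX r c

/-- The Leibniz rule for higher derivatives of a product of matrix curves. -/
theorem dmat_mul {M N L : ℕ} {A : ℝ → Matrix (Fin M) (Fin N) ℝ}
    {B : ℝ → Matrix (Fin N) (Fin L) ℝ} (hA : MatSmooth A) (hB : MatSmooth B) (m : ℕ) (t : ℝ) :
    dmat m (fun s => A s * B s) t =
      ∑ l ∈ Finset.range (m + 1), (m.choose l : ℝ) • (dmat (m - l) A t * dmat l B t) := by
  ext r c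
  have hm : ((m : ℕ∞) : WithTop ℕ∞) ≤ ((⊤ : ℕ∞) : WithTop ℕ∞) := by exact_mod_cast le_top
  have hA' : ∀ i j, ContDiffAt ℝ m (fun s => A s i j) t :=
    fun i j => ((hA i j).of_le hm).contDiffAt
  have hB' : ∀ i j, ContDiffAt ℝ m (fun s => B s i j) t :=
    fun i j => ((hB i j).of_le hm).contDiffAt
  have hmul : ∀ p, iteratedDeriv m (fun s => A s r p * B s p c) t =
      ∑ l ∈ Finset.range (m + 1), (m.choose l : ℝ) * (dmat (m - l) A t r p * dmat l B t p c) := by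
    intro p
    have h := iteratedDeriv_mul (hB' p c) (hA' r p)
    rw [mul_comm] at h
    refine h.trans (Finset.sum_congr rfl fun l _ => ?_)
    rw [dmat_apply, dmat_apply]
    ring
  rw [dmat_apply]
  simp only [Matrix.mul_apply, Matrix.sum_apply, Matrix.smul_apply, smul_eq_mul, Finset.mul_sum]
  rw [iteratedDeriv_fun_sum fun p _ => (hA' r p).mul (hB' p c), Finset.sum_comm]
  exact Finset.sum_congr rfl fun p _ => hmul p

theorem juxt_mul_of (k n : ℕ) {ι : Type*} (B : Fin k → Matrix (Fin (k * n)) (Fin n) ℝ)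
    (W : Fin k → Matrix (Fin n) ι ℝ) :
    juxt k n B * (Matrix.of fun r c => W (finProdFinEquiv.symm r).1 (finProdFinEquiv.symm r).2 c) =
      ∑ i, B i * W i := by
  ext r c
  simp only [Matrix.mul_apply, Matrix.sum_apply, juxt, Matrix.of_apply]
  rw [← Fintype.sum_prod_type', ← finProdFinEquiv.symm.sum_comp]

/-- Block vectors are determined by their image under an invertible juxtaposition. -/
theorem eq_zero_of_sum_mul_eq_zero {k n : ℕ} {B : Fin k → Matrix (Fin (k * n)) (Fin n) ℝ}
    (hB : IsUnit (juxt k n B)) {W : Fin k → Matrix (Fin n) (Fin n) ℝ}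
    (h : ∑ i, B i * W i = 0) (i : Fin k) : W i = 0 := by
  rw [← juxt_mul_of] at h
  have hW := congrArg ((juxt k n B)⁻¹ * ·) h
  simp only [Matrix.nonsing_inv_mul_cancel_left _ _ ((Matrix.isUnit_iff_isUnit_det _).1 hB),
    Matrix.mul_zero] at hW
  ext a b
  simpa only [Matrix.of_apply, Equiv.symm_apply_apply, Matrix.zero_apply] using
    congrFun (congrFun hW (finProdFinEquiv (i, a))) b

/-- If every block of an invertible juxtaposition is a right combination of the blocks `B p`,
then the juxtaposition of `B` is invertible. -/
theorem isUnit_juxt_of_eq_sum {k n : ℕ} {A B : Fin k → Matrix (Fin (k * n)) (Fin n) ℝ}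
    (hA : IsUnit (juxt k n A)) (T : Fin k → Fin k → Matrix (Fin n) (Fin n) ℝ)
    (h : ∀ q, A q = ∑ p, B p * T p q) : IsUnit (juxt k n B) := by
  refine isUnit_of_mul_isUnit_left (y := Matrix.of fun r c =>
    T (finProdFinEquiv.symm r).1 (finProdFinEquiv.symm c).1 (finProdFinEquiv.symm r).2
      (finProdFinEquiv.symm c).2) ?_
  convert hA
  have := juxt_mul_of k n B (fun p => Matrix.of fun a c =>
    T p (finProdFinEquiv.symm c).1 a (finProdFinEquiv.symm c).2)
  refine this.trans ?_
  ext r c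
  simp [juxt, h, Matrix.sum_apply, Matrix.mul_apply]

theorem isFanning_of_mul {k n : ℕ} {B : ℝ → Matrix (Fin (k * n)) (Fin n) ℝ}
    {X : ℝ → Matrix (Fin n) (Fin n) ℝ} (hB : MatSmooth B) (hX : MatSmooth X)
    (h : IsFanning k n fun t => B t * X t) : IsFanning k n B := by
  refine ⟨hB, fun t => isUnit_juxt_of_eq_sum (h.2 t) (fun p q =>
    if (p : ℕ) ≤ q then ((q : ℕ).choose p : ℝ) • dmat (q - p) X t else 0) fun q => ?_⟩
  rw [dmat_mul hB hX, ← Finset.sum_range_reflect, Fin.sum_univ_eq_sum_range (fun p =>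
    dmat p B t * if p ≤ (q : ℕ) then ((q : ℕ).choose p : ℝ) • dmat (q - p) X t else 0) k]
  rw [← Finset.sum_subset (Finset.range_subset_range.2 (Nat.succ_le_of_lt q.2))]
  · refine Finset.sum_congr rfl fun p hp => ?_
    have hp : p ≤ q := Nat.lt_succ_iff.1 (Finset.mem_range.1 hp)
    rw [if_pos hp, Matrix.mul_smul, show (q : ℕ) + 1 - 1 - p = q - p by omega,
      Nat.choose_symm hp, Nat.sub_sub_self hp]
  · intro p _ hp
    rw [if_neg (by simpa [Nat.lt_succ_iff] using hp), Matrix.mul_zero]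

/-- The numerators of the coefficient curves under the change of frame `A = B X`. -/
noncomputable def gaugeSum {n : ℕ} (X : ℝ → Matrix (Fin n) (Fin n) ℝ)
    (P : ℕ → ℝ → Matrix (Fin n) (Fin n) ℝ) (j : ℕ) (t : ℝ) : Matrix (Fin n) (Fin n) ℝ :=
  ∑ i ∈ Finset.range (j + 1), (j.choose i : ℝ) •
    (dmat (j - i) X t * (if i = 0 then 1 else P i t))

theorem sum_dmat_mul_gaugeSum {k n N : ℕ} {B : ℝ → Matrix (Fin N) (Fin n) ℝ}
    {X : ℝ → Matrix (Fin n) (Fin n) ℝ} (hB : MatSmooth B) (hX : MatSmooth X)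
    (P : ℕ → ℝ → Matrix (Fin n) (Fin n) ℝ) (t : ℝ) :
    ∑ j ∈ Finset.range (k + 1), (k.choose j : ℝ) • (dmat (k - j) B t * gaugeSum X P j t) =
      ∑ i ∈ Finset.range (k + 1), (k.choose i : ℝ) •
        (dmat (k - i) (fun s => B s * X s) t * (if i = 0 then 1 else P i t)) := by
  have hflip := Finset.sum_range_diag_flip (k + 1) fun i l =>
    ((k.choose (i + l) * (i + l).choose i : ℕ) : ℝ) •
      (dmat (k - (i + l)) B t * dmat l X t * (if i = 0 then 1 else P i t))
  refine Eq.trans ?_ (hflip.trans ?_)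
  · refine Finset.sum_congr rfl fun j _ => ?_
    rw [gaugeSum, Matrix.mul_sum, Finset.smul_sum]
    refine Finset.sum_congr rfl fun i hi => ?_
    rw [Nat.add_sub_cancel' (Nat.lt_succ_iff.1 (Finset.mem_range.1 hi)), Matrix.mul_smul,
      smul_smul, Matrix.mul_assoc, Nat.cast_mul]
  · refine Finset.sum_congr rfl fun i hi => ?_
    have hi : i ≤ k := Nat.lt_succ_iff.1 (Finset.mem_range.1 hi)
    rw [dmat_mul hB hX, Matrix.sum_mul, Finset.smul_sum, Nat.sub_add_comm hi]
    refine Finset.sum_congr rfl fun l _ => ?_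
    rw [Nat.choose_mul (Nat.le_add_right i l), Nat.add_sub_cancel_left, Matrix.smul_mul, smul_smul,
      Nat.cast_mul, Nat.sub_sub]

theorem isCoeffs_sum_range {k n : ℕ} {A : ℝ → Matrix (Fin (k * n)) (Fin n) ℝ}
    {P : ℕ → ℝ → Matrix (Fin n) (Fin n) ℝ} (hP : IsCoeffs k n A P) (t : ℝ) :
    ∑ i ∈ Finset.range (k + 1), (k.choose i : ℝ) •
        (dmat (k - i) A t * (if i = 0 then 1 else P i t)) = 0 := by
  rw [← hP.2 t, Finset.range_eq_Ico, Finset.sum_eq_sum_Ico_succ_bot (Nat.succ_pos k)]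
  congr 1
  · simp
  · refine Finset.sum_congr rfl fun i hi => ?_
    rw [if_neg (by have := (Finset.mem_Ico.1 hi).1; omega)]

theorem coeffs_unique {k n : ℕ} {B : ℝ → Matrix (Fin (k * n)) (Fin n) ℝ} {t : ℝ}
    (hB : IsUnit (frameMat k n B t)) {Q R : ℕ → Matrix (Fin n) (Fin n) ℝ}
    (hQR : Q 0 = R 0)
    (h : ∑ i ∈ Finset.range (k + 1), (k.choose i : ℝ) • (dmat (k - i) B t * Q i) =
      ∑ i ∈ Finset.range (k + 1), (k.choose i : ℝ) • (dmat (k - i) B t * R i))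
    {j : ℕ} (hj : j ∈ Finset.Icc 1 k) : Q j = R j := by
  have hj := Finset.mem_Icc.1 hj
  have hsum : ∑ i : Fin k, dmat i B t *
      ((k.choose i : ℝ) • (Q (k - i) - R (k - i))) = 0 := by
    rw [Fin.sum_univ_eq_sum_range
      (fun i => dmat i B t * ((k.choose i : ℝ) • (Q (k - i) - R (k - i)))) k]
    rw [← sub_eq_zero, ← Finset.sum_sub_distrib, ← Finset.sum_range_reflect,
      Finset.sum_range_succ] at h
    simp only [add_tsub_cancel_right, Nat.sub_self, hQR, sub_self, add_zero] at h
    rw [← h]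
    refine Finset.sum_congr rfl fun i hi => ?_
    have hi := (Finset.mem_range.1 hi).le
    rw [Nat.sub_sub_self hi, Nat.choose_symm hi, Matrix.mul_smul, Matrix.mul_sub, smul_sub]
  have hz := eq_zero_of_sum_mul_eq_zero hB hsum ⟨k - j, by omega⟩
  have hc : (k.choose (k - j) : ℝ) ≠ 0 :=
    Nat.cast_ne_zero.2 (Nat.choose_pos (Nat.sub_le k j)).ne'
  simpa [hc, Nat.sub_sub_self hj.2, sub_eq_zero] using hz

theorem gaugeSum_one {n : ℕ} {X : ℝ → Matrix (Fin n) (Fin n) ℝ}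
    {P : ℕ → ℝ → Matrix (Fin n) (Fin n) ℝ} (hXd : ∀ t, mderiv X t = -(X t * P 1 t)) (t : ℝ) :
    gaugeSum X P 1 t = 0 := by
  simp [gaugeSum, Finset.sum_range_succ, dmat, hXd]

theorem mderiv_mul {M N L : ℕ} {A : ℝ → Matrix (Fin M) (Fin N) ℝ}
    {B : ℝ → Matrix (Fin N) (Fin L) ℝ} (hA : MatSmooth A) (hB : MatSmooth B) (t : ℝ) :
    mderiv (fun s => A s * B s) t = mderiv A t * B t + A t * mderiv B t := by
  simpa [Finset.sum_range_succ, dmat] using dmat_mul hA hB 1 t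

theorem mderiv_neg {M N : ℕ} (A : ℝ → Matrix (Fin M) (Fin N) ℝ) (t : ℝ) :
    mderiv (fun s => -A s) t = -mderiv A t := by
  ext i j
  simp [mderiv]

theorem gaugeSum_two {n : ℕ} {X : ℝ → Matrix (Fin n) (Fin n) ℝ}
    {P : ℕ → ℝ → Matrix (Fin n) (Fin n) ℝ} (hX : MatSmooth X) (hP : MatSmooth (P 1))
    (hXd : ∀ t, mderiv X t = -(X t * P 1 t)) (t : ℝ) :
    gaugeSum X P 2 t = X t * (P 2 t - P 1 t * P 1 t - mderiv (P 1) t) := by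
  have h2 : mderiv (mderiv X) t = X t * P 1 t * P 1 t - X t * mderiv (P 1) t := by
    rw [funext hXd, mderiv_neg, mderiv_mul hX hP, hXd]
    noncomm_ring
  simp only [gaugeSum, Finset.sum_range_succ, dmat, Finset.sum_range_zero]
  simp [h2, hXd, two_smul]
  noncomm_ring

/-- If `X' = -X P₁`, `X 0 = 1`, `X` invertible, then `B t = A t * (X t)⁻¹`
is a (normal) fanning frame whose coefficient curves are
`Q_j = (∑_{i=0}^{j} C(j,i) X^{(j-i)} P_i) X⁻¹` (with `P₀ = 1`); in particular `Q₁ ≡ 0`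
and `Q₂ = X (P₂ - P₁² - P₁') X⁻¹`. -/
theorem stmt_1 (k n : ℕ) (hk : 2 ≤ k) (hn : 1 ≤ n)
    (A : ℝ → Matrix (Fin (k * n)) (Fin n) ℝ) (hA : IsFanning k n A)
    (P : ℕ → ℝ → Matrix (Fin n) (Fin n) ℝ) (hP : IsCoeffs k n A P)
    (X : ℝ → Matrix (Fin n) (Fin n) ℝ) (hXs : MatSmooth X) (hX0 : X 0 = 1)
    (hXu : ∀ t, IsUnit (X t)) (hXd : ∀ t, mderiv X t = -(X t * P 1 t)) :
    IsFanning k n (fun t => A t * (X t)⁻¹) ∧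
    ∀ Q : ℕ → ℝ → Matrix (Fin n) (Fin n) ℝ,
      IsCoeffs k n (fun t => A t * (X t)⁻¹) Q →
      (∀ j ∈ Finset.Icc 1 k, ∀ t, Q j t =
          (∑ i ∈ Finset.range (j + 1), (j.choose i : ℝ) •
            (dmat (j - i) X t * (if i = 0 then 1 else P i t))) * (X t)⁻¹) ∧
      (∀ t, Q 1 t = 0) ∧
      (∀ t, Q 2 t = X t * (P 2 t - P 1 t * P 1 t - mderiv (P 1) t) * (X t)⁻¹) := by
  have hBs : MatSmooth fun t => A t * (X t)⁻¹ := matSmooth_mul hA.1 (hXs.inv hXu)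
  have hdet : ∀ t, IsUnit (X t).det := fun t => (Matrix.isUnit_iff_isUnit_det _).1 (hXu t)
  have hBX : (fun t => A t * (X t)⁻¹ * X t) = A :=
    funext fun t => Matrix.nonsing_inv_mul_cancel_right _ _ (hdet t)
  have hB : IsFanning k n fun t => A t * (X t)⁻¹ :=
    isFanning_of_mul hBs hXs (by rwa [hBX])
  refine ⟨hB, fun Q hQ => ?_⟩
  have key : ∀ j ∈ Finset.Icc 1 k, ∀ t, Q j t = gaugeSum X P j t * (X t)⁻¹ := by
    intro j hj t
    have hR := sum_dmat_mul_gaugeSum (k := k) hBs hXs P t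
    rw [hBX, isCoeffs_sum_range hP] at hR
    have hR' := congrArg (· * (X t)⁻¹) hR
    simp only [Matrix.sum_mul, Matrix.smul_mul, Matrix.mul_assoc, Matrix.zero_mul] at hR'
    have h := coeffs_unique (hB.2 t) (Q := fun i => if i = 0 then 1 else Q i t)
      (R := fun i => gaugeSum X P i t * (X t)⁻¹)
      (by simp [gaugeSum, dmat, Matrix.mul_nonsing_inv _ (hdet t)])
      ((isCoeffs_sum_range hQ t).trans hR'.symm) hj
    rwa [if_neg (by have := (Finset.mem_Icc.1 hj).1; omega)] at h
  have h1 : 1 ∈ Finset.Icc 1 k := Finset.mem_Icc.2 ⟨le_rfl, by omega⟩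
  refine ⟨key, fun t => ?_, fun t => ?_⟩
  · rw [key 1 h1, gaugeSum_one hXd, Matrix.zero_mul]
  · rw [key 2 (Finset.mem_Icc.2 ⟨by omega, hk⟩), gaugeSum_two hXs (hP.1 1 h1) hXd]
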